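/- In any BDRG A, the following are equivalent: (1) p → q ≤ (q → r) → (p → r) holds for all p, q, r ∈ A (axiom (B')); (2) p • (t • s) ≤ (p • s) • t holds for all p, s, t ∈ A (rule (b')). -/

import Mathlib

/-- A bounded distributive lattice-ordered residuated groupoid (BDRG):
a bounded distributive lattice with operations `prod` (•), `imp` (→), `limp` (←)
satisfying the residuation law: a • b ≤ c ↔ b ≤ a → c ↔ a ≤ c ← b. -/
structure BDRG (A : Type*) [DistribLattice A] [BoundedOrder A] where
  prod : A → A → A
  imp : A → A → A
  limp : A → A → A
  res_imp : ∀ a b c : A, prod a b ≤ c ↔ b ≤ imp a c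
  res_limp : ∀ a b c : A, prod a b ≤ c ↔ a ≤ limp c b

theorem corr_B'_b' {A : Type*} [DistribLattice A] [BoundedOrder A] (G : BDRG A) :
    (∀ p q r : A, G.imp p q ≤ G.imp (G.imp q r) (G.imp p r)) ↔
    (∀ p s t : A, G.prod p (G.prod t s) ≤ G.prod (G.prod p s) t) := by
  have ml : ∀ a b c : A, a ≤ b → G.prod a c ≤ G.prod b c := fun a b c h =>
    (G.res_limp _ _ _).2 (h.trans ((G.res_limp _ _ _).1 le_rfl))
  have mr : ∀ a b c : A, a ≤ b → G.prod c a ≤ G.prod c b := fun a b c h =>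
    (G.res_imp _ _ _).2 (h.trans ((G.res_imp _ _ _).1 le_rfl))
  constructor
  · intro h p s t
    rw [G.res_imp]
    have h1 := (G.res_imp _ _ _).2 (h p (G.prod p s) (G.prod (G.prod p s) t))
    refine le_trans ?_ h1
    exact (ml _ _ _ ((G.res_imp _ _ _).1 le_rfl)).trans (mr _ _ _ ((G.res_imp _ _ _).1 le_rfl))
  · intro h p q r
    rw [← G.res_imp, ← G.res_imp]
    exact (h _ _ _).trans ((ml _ _ _ ((G.res_imp _ _ _).2 le_rfl)).trans ((G.res_imp _ _ _).2 le_rfl))
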